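/- Let j ≥ 3 and δ ≥ 3 be integers such that δ + 1 is a power of a prime number. Then there exists a finite connected simple graph with no 4-cycle, minimum degree δ, equator q = 5j, and order n = j·(δ² + 3δ + 2) = (q/5)(δ² + 3δ + 2). -/

import Mathlib

open SimpleGraph

/-- The distance between two indices around a cycle of length `q`. -/
def cycleDist {q : ℕ} (i j : ZMod q) : ℕ := min (i - j).val (j - i).val

/-- `f` lists the vertices (in cyclic order) of an isometric cycle of length `q` in `G`:
the distance in `G` between any two of its vertices equals their distance along the cycle. -/
def IsIsoCycle {V : Type*} (G : SimpleGraph V) (q : ℕ) (f : ZMod q → V) : Prop :=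
  3 ≤ q ∧ ∀ i j : ZMod q, G.dist (f i) (f j) = cycleDist i j

/-- `G` has an isometric cycle of length `q`. -/
def HasIsoCycle {V : Type*} (G : SimpleGraph V) (q : ℕ) : Prop :=
  ∃ f : ZMod q → V, IsIsoCycle G q f

/-- The equator of `G` is `q`: `q` is the length of a longest isometric cycle of `G`
(`0` if `G` has no isometric cycle, e.g. if `G` is acyclic). -/
def IsEquator {V : Type*} (G : SimpleGraph V) (q : ℕ) : Prop :=
  (HasIsoCycle G q ∨ (q = 0 ∧ ∀ q', ¬ HasIsoCycle G q')) ∧ ∀ q', HasIsoCycle G q' → q' ≤ q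

/-- The degree of a vertex, as the cardinality of its neighbor set. -/
noncomputable def ndeg {V : Type*} (G : SimpleGraph V) (v : V) : ℕ := (G.neighborSet v).ncard

/-- `G` has minimum degree `δ`. -/
def HasMinDegree {V : Type*} (G : SimpleGraph V) (δ : ℕ) : Prop :=
  (∀ v, δ ≤ ndeg G v) ∧ ∃ v, ndeg G v = δ

/-- The Moore bound `M(δ, g)`. -/
def mooreBound (δ g : ℕ) : ℕ :=
  if Odd g then 1 + δ * ∑ i ∈ Finset.range ((g + 1) / 2 - 1), (δ - 1) ^ i
  else 2 + ∑ i ∈ Finset.Icc 1 ((g + 1) / 2 - 1), 2 * (δ - 1) ^ i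

/-- The disk of radius `k` around a vertex `u`. -/
def disk {V : Type*} (G : SimpleGraph V) (k : ℕ) (u : V) : Set V := {v | G.dist u v ≤ k}

/-- The disk of radius `k` around an edge `uv`. -/
def edisk {V : Type*} (G : SimpleGraph V) (k : ℕ) (u v : V) : Set V :=
  disk G k u ∪ disk G k v

/-- `G` is an equatorial graph with minimum degree `δ`, girth `g` and equator `q`:
a finite connected simple graph with girth `g`, minimum degree `δ`, equator `q > 6k + 3`
(where `k = ⌈g/2⌉ - 1`) whose order attains the bound `n = (q/g) · M(δ, g)`. -/
def IsEquatorial {V : Type*} (G : SimpleGraph V) (δ g q : ℕ) : Prop :=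
  Finite V ∧ G.Connected ∧ G.girth = g ∧ HasMinDegree G δ ∧ IsEquator G q ∧
    6 * ((g + 1) / 2 - 1) + 3 < q ∧ g * Nat.card V = q * mooreBound δ g

/-- The part `L i` of the partition induced by the isometric cycle `f`:
`L i = D_k(u_{i-k}) ∩ D_k(u_{i+k})`. -/
def Lpart {V : Type*} (G : SimpleGraph V) (k : ℕ) {q : ℕ} (f : ZMod q → V) (i : ZMod q) :
    Set V :=
  disk G k (f (i - (k : ZMod q))) ∩ disk G k (f (i + (k : ZMod q)))

/-- The orthogonality relation of a projective plane of order `m` with a polarity. -/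
structure IsPolarity {P : Type*} (R : P → P → Prop) (m : ℕ) : Prop where
  symm : ∀ {x y}, R x y → R y x
  exists_common : ∀ {x y}, x ≠ y → ∃ z, R x z ∧ R y z
  eq_or_eq : ∀ {x y z w}, R x z → R y z → R x w → R y w → x = y ∨ z = w
  ncard_eq : ∀ x, {y | R x y}.ncard = m + 1
  card_eq : Nat.card P = m ^ 2 + m + 1

theorem exists_isotropic (F : Type*) [Field F] [Finite F] :
    ∃ u : Fin 3 → F, u ≠ 0 ∧ u ⬝ᵥ u = 0 := by
  have := Fintype.ofFinite F
  by_cases h2 : ringChar F = 2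
  · have : CharP F 2 := ringChar.of_eq h2
    refine ⟨![1, 1, 0], fun h => one_ne_zero (congrFun h 0), ?_⟩
    simp [Matrix.dotProduct_cons, CharTwo.add_self_eq_zero]
  · obtain ⟨x, y, h⟩ := FiniteField.exists_root_sum_quadratic (R := F)
      (f := Polynomial.X ^ 2) (g := Polynomial.X ^ 2 - Polynomial.C (-1))
      (Polynomial.degree_X_pow 2) (Polynomial.degree_X_pow_sub_C (by decide) _)
      (FiniteField.odd_card_of_char_ne_two h2)
    refine ⟨![x, y, 1], fun h => one_ne_zero (congrFun h 2), ?_⟩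
    simp at h
    simp [Matrix.dotProduct_cons]
    linear_combination h

open scoped LinearAlgebra.Projectivization in
open Configuration in
theorem isPolarity_orthogonal (F : Type*) [Field F] [Finite F] :
    IsPolarity (Projectivization.orthogonal (F := F) (m := Fin 3)) (Nat.card F) := by
  classical
  have := Fintype.ofFinite (ℙ F (Fin 3 → F))
  have hcard : Nat.card (ℙ F (Fin 3 → F)) = Nat.card F ^ 2 + Nat.card F + 1 := by
    rw [Projectivization.card_of_finrank F (Fin 3 → F) (n := 3) (by simp)]
    simp [Finset.sum_range_succ]
    ring
  have horder : ProjectivePlane.order (ℙ F (Fin 3 → F)) (ℙ F (Fin 3 → F)) = Nat.card F := by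
    have h := ProjectivePlane.card_points (ℙ F (Fin 3 → F)) (ℙ F (Fin 3 → F))
    rw [← Nat.card_eq_fintype_card, hcard] at h
    rcases lt_trichotomy (Nat.card F)
      (ProjectivePlane.order (ℙ F (Fin 3 → F)) (ℙ F (Fin 3 → F))) with h' | h' | h'
    · nlinarith
    · exact h'.symm
    · nlinarith
  refine ⟨fun h => Projectivization.orthogonal_comm.1 h, fun {x y} h =>
    ⟨Projectivization.cross x y, Projectivization.orthogonal_cross_left h,
      Projectivization.orthogonal_cross_right h⟩,
    fun h₁ h₂ h₃ h₄ => ofField.eq_or_eq_of_orthogonal h₁ h₂ h₃ h₄, fun x => ?_, hcard⟩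
  rw [← horder, ← ProjectivePlane.lineCount_eq (ℙ F (Fin 3 → F)) x]
  rfl

theorem exists_isPolarity_isotropic {m : ℕ} (hm : IsPrimePow m) :
    ∃ (P : Type) (R : P → P → Prop), IsPolarity R m ∧ ∃ c, R c c := by
  obtain ⟨F⟩ : Nonempty (Field (Fin m)) := Fintype.nonempty_field_iff.2 (by simpa using hm)
  obtain ⟨u, hu, h⟩ := exists_isotropic (Fin m)
  refine ⟨_, _, by simpa using isPolarity_orthogonal (Fin m), Projectivization.mk (Fin m) u hu, h⟩

/-- `G` has a walk of length at most `n` from `x` to `y`. -/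
def Near {V : Type*} (G : SimpleGraph V) (n : ℕ) (x y : V) : Prop :=
  ∃ p : G.Walk x y, p.length ≤ n

namespace Near

variable {V W : Type*} {G : SimpleGraph V} {H : SimpleGraph W} {m n : ℕ} {x y z : V}

theorem refl (n : ℕ) (x : V) : Near G n x x := ⟨Walk.nil, Nat.zero_le n⟩

theorem symm (h : Near G n x y) : Near G n y x := by
  obtain ⟨p, hp⟩ := h
  exact ⟨p.reverse, by simpa using hp⟩

theorem trans (h : Near G m x y) (h' : Near G n y z) : Near G (m + n) x z := by
  obtain ⟨p, hp⟩ := h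
  obtain ⟨p', hp'⟩ := h'
  exact ⟨p.append p', by rw [Walk.length_append]; omega⟩

theorem mono (h : Near G m x y) (hmn : m ≤ n) : Near G n x y :=
  h.imp fun _ hp => hp.trans hmn

theorem of_adj (h : G.Adj x y) : Near G 1 x y := ⟨h.toWalk, by simp⟩

theorem map (f : G →g H) (h : Near G n x y) : Near H n (f x) (f y) := by
  obtain ⟨p, hp⟩ := h
  exact ⟨p.map f, by simpa using hp⟩

theorem dist_le (h : Near G n x y) : G.dist x y ≤ n := by
  obtain ⟨p, hp⟩ := h
  exact (SimpleGraph.dist_le p).trans hp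

theorem reachable (h : Near G n x y) : G.Reachable x y := h.elim fun p _ => ⟨p⟩

end Near

/-- A point `v` with two non-orthogonal points `a`, `b` and an isotropic point `c`
on its polar line. -/
structure IsFrame {P : Type*} (R : P → P → Prop) (v a b c : P) : Prop where
  va : R v a
  vb : R v b
  vc : R v c
  ne_a : a ≠ v
  ne_b : b ≠ v
  ne_c : c ≠ v
  a_ne_b : a ≠ b
  c_ne_a : c ≠ a
  c_ne_b : c ≠ b
  not_ab : ¬ R a b
  cc : R c c

/-- The polarity graph with the vertex `v` removed, together with all edges between
the neighbours of `a` and the neighbours of `b`. -/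
def blockGraph {P : Type*} {R : P → P → Prop} {m : ℕ} (hR : IsPolarity R m) (v a b : P) :
    SimpleGraph {x : P // x ≠ v} where
  Adj x y := x ≠ y ∧ R x y ∧ ¬ (R x a ∧ R y b) ∧ ¬ (R x b ∧ R y a)
  symm := ⟨fun _ _ h => ⟨h.1.symm, hR.symm h.2.1, fun h' => h.2.2.2 ⟨h'.2, h'.1⟩,
    fun h' => h.2.2.1 ⟨h'.2, h'.1⟩⟩⟩
  loopless := ⟨fun _ h => h.1 rfl⟩

open Classical in
/-- The distance from `a` to `x` in the block graph, truncated on the part that is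
close to neither `a` nor `b`. -/
noncomputable def level {P : Type*} (R : P → P → Prop) (a b x : P) : ℕ :=
  if x = a then 0 else if x = b then 4 else if R x a then 1 else if R x b then 3 else 2

namespace IsPolarity

variable {P : Type*} {R : P → P → Prop} {m : ℕ}

theorem finite (hR : IsPolarity R m) : Finite P :=
  Nat.finite_of_card_ne_zero (by rw [hR.card_eq]; omega)

theorem common_unique (hR : IsPolarity R m) {x y z w : P} (hxy : x ≠ y) (h₁ : R x z) (h₂ : R y z)
    (h₃ : R x w) (h₄ : R y w) : z = w :=
  (hR.eq_or_eq h₁ h₂ h₃ h₄).resolve_left hxy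

/-- A polar line is not covered by fewer than `m + 1` points. -/
theorem exists_not_mem (hR : IsPolarity R m) (x : P) (s : Finset P) (hs : s.card ≤ m) :
    ∃ y, R x y ∧ y ∉ s := by
  by_contra! h
  have := Set.ncard_le_ncard (s := {y | R x y}) (t := (s : Set P)) (fun y hy => h y hy)
    (Finset.finite_toSet s)
  rw [hR.ncard_eq, Set.ncard_coe_finset] at this
  omega

theorem exists_isFrame (hR : IsPolarity R m) (hm : 3 ≤ m) {c : P} (hc : R c c) :
    ∃ v a b, IsFrame R v a b c := by
  classical
  obtain ⟨v, hcv, hvc⟩ := hR.exists_not_mem c {c} (by simp; omega)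
  rw [Finset.mem_singleton] at hvc
  have hvv : ¬ R v v := fun h => hvc (hR.common_unique (Ne.symm hvc) hcv h hc (hR.symm hcv))
  obtain ⟨a, hva, hac⟩ := hR.exists_not_mem v {c} (by simp; omega)
  rw [Finset.mem_singleton] at hac
  have hav : a ≠ v := fun h => hvv (h ▸ hva)
  obtain ⟨d, had, hvd⟩ := hR.exists_common hav
  obtain ⟨b, hvb, hb⟩ := hR.exists_not_mem v {c, a, d} (Finset.card_le_three.trans hm)
  simp only [Finset.mem_insert, Finset.mem_singleton, not_or] at hb
  exact ⟨v, a, b, hva, hvb, hR.symm hcv, hav, fun h => hvv (h ▸ hvb), Ne.symm hvc,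
    Ne.symm hb.2.1, Ne.symm hac, Ne.symm hb.1,
    fun h => hb.2.2 (hR.common_unique hav h hvb had hvd), hc⟩

end IsPolarity

namespace IsFrame

variable {P : Type*} {R : P → P → Prop} {m : ℕ} {v a b c : P}

theorem swap (hR : IsPolarity R m) (hF : IsFrame R v a b c) : IsFrame R v b a c :=
  ⟨hF.vb, hF.va, hF.vc, hF.ne_b, hF.ne_a, hF.ne_c, hF.a_ne_b.symm, hF.c_ne_b, hF.c_ne_a,
    fun h => hF.not_ab (hR.symm h), hF.cc⟩

theorem blockGraph_comm (hR : IsPolarity R m) :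
    blockGraph hR v a b = blockGraph hR v b a := by
  ext x y
  simp only [blockGraph]
  tauto

theorem eq_of_common (hR : IsPolarity R m) (hF : IsFrame R v a b c) {x : P}
    (ha : R x a) (hb : R x b) : x = v :=
  hR.common_unique hF.a_ne_b (hR.symm ha) (hR.symm hb) (hR.symm hF.va) (hR.symm hF.vb)

theorem level_le (hR : IsPolarity R m) (hF : IsFrame R v a b c) {x y : {x : P // x ≠ v}}
    (h : (blockGraph hR v a b).Adj x y) : level R a b y ≤ level R a b x + 1 := by
  obtain ⟨hne, hxy, h₁, h₂⟩ := h
  have hx := fun h h' => x.2 (hF.eq_of_common hR h h')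
  have hy := fun h h' => y.2 (hF.eq_of_common hR h h')
  have hyx := hR.symm hxy
  have hab := hF.not_ab
  have hba := fun h => hF.not_ab (hR.symm h)
  unfold level
  grind

theorem block_c4free (hR : IsPolarity R m) (w x y z : {x : P // x ≠ v})
    (h₁ : (blockGraph hR v a b).Adj w x) (h₂ : (blockGraph hR v a b).Adj x y)
    (h₃ : (blockGraph hR v a b).Adj y z) (h₄ : (blockGraph hR v a b).Adj z w) :
    w = y ∨ x = z := by
  rw [Subtype.ext_iff, Subtype.ext_iff]
  exact hR.eq_or_eq h₁.2.1 (hR.symm h₂.2.1) (hR.symm h₄.2.1) h₃.2.1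

/-- In the block graph every vertex loses at most two of the points orthogonal to it. -/
theorem exists_forall_adj (hR : IsPolarity R m) (hF : IsFrame R v a b c) (x : {x : P // x ≠ v}) :
    ∃ d : P, ∀ y, R x y → y ≠ x → y ≠ d →
      ∃ hy : y ≠ v, (blockGraph hR v a b).Adj x ⟨y, hy⟩ := by
  have hx := fun h h' => x.2 (hF.eq_of_common hR h h')
  have hba := fun h => hF.not_ab (hR.symm h)
  by_cases hxa : R x a
  · have hxb : x.1 ≠ b := by rintro h; exact hba (h ▸ hxa)
    obtain ⟨d, hxd, hbd⟩ := hR.exists_common hxb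
    refine ⟨d, fun y hxy hyx hyd => ⟨?_, ?_, hxy, ?_, fun h => hx hxa h.1⟩⟩
    · rintro rfl
      exact hyd (hR.common_unique hxb hxy (hR.symm hF.vb) hxd hbd)
    · exact fun h => hyx (congrArg Subtype.val h).symm
    · exact fun h => hyd (hR.common_unique hxb hxy (hR.symm h.2) hxd hbd)
  by_cases hxb : R x b
  · have hxa : x.1 ≠ a := by rintro h; exact hF.not_ab (h ▸ hxb)
    obtain ⟨d, hxd, had⟩ := hR.exists_common hxa
    refine ⟨d, fun y hxy hyx hyd => ⟨?_, ?_, hxy, fun h => hx h.1 hxb, ?_⟩⟩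
    · rintro rfl
      exact hyd (hR.common_unique hxa hxy (hR.symm hF.va) hxd had)
    · exact fun h => hyx (congrArg Subtype.val h).symm
    · exact fun h => hyd (hR.common_unique hxa hxy (hR.symm h.2) hxd had)
  · exact ⟨v, fun y hxy hyx hyv => ⟨hyv, fun h => hyx (congrArg Subtype.val h).symm, hxy,
      fun h => hxa h.1, fun h => hxb h.1⟩⟩

theorem le_ndeg (hR : IsPolarity R m) (hF : IsFrame R v a b c) (x : {x : P // x ≠ v}) :
    m - 1 ≤ ndeg (blockGraph hR v a b) x := by
  have := hR.finite
  obtain ⟨d, hd⟩ := hF.exists_forall_adj hR x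
  have h : {y | R x y} ⊆
      Subtype.val '' (blockGraph hR v a b).neighborSet x ∪ {x.1, d} := by
    intro y hy
    by_cases h₁ : y = x
    · simp [h₁]
    by_cases h₂ : y = d
    · simp [h₂]
    obtain ⟨hv, h⟩ := hd y hy h₁ h₂
    exact Or.inl ⟨⟨y, hv⟩, h, rfl⟩
  have h₁ := (Set.ncard_le_ncard h).trans (Set.ncard_union_le _ _)
  rw [hR.ncard_eq, Set.ncard_image_of_injective _ Subtype.val_injective] at h₁
  have h₂ : ({x.1, d} : Set P).ncard ≤ 2 :=
    (Set.ncard_insert_le _ _).trans (by rw [Set.ncard_singleton])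
  unfold ndeg
  omega

theorem ndeg_isotropic_le (hR : IsPolarity R m) (hF : IsFrame R v a b c) :
    ndeg (blockGraph hR v a b) ⟨c, hF.ne_c⟩ ≤ m - 1 := by
  have := hR.finite
  have h : Subtype.val '' (blockGraph hR v a b).neighborSet ⟨c, hF.ne_c⟩ ⊆
      {y | R c y} \ {c, v} := by
    rintro _ ⟨y, hy, rfl⟩
    refine ⟨hy.2.1, ?_⟩
    rintro (h | h)
    · exact hy.1 (Subtype.ext h.symm)
    · exact y.2 h
  have h₁ := Set.ncard_le_ncard h
  rw [Set.ncard_image_of_injective _ Subtype.val_injective, Set.ncard_sdiff (by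
    rintro _ (rfl | rfl)
    exacts [hF.cc, hR.symm hF.vc]), hR.ncard_eq, Set.ncard_pair hF.ne_c] at h₁
  exact h₁

theorem near_two (hR : IsPolarity R m) (hF : IsFrame R v a b c) {x : {x : P // x ≠ v}}
    (hb : ¬ R x b) (ha : ¬ R x a) (hv : ¬ R x v) :
    ∃ y, (blockGraph hR v a b).Adj x y ∧
      (blockGraph hR v a b).Adj y ⟨a, hF.ne_a⟩ := by
  have hxa : x.1 ≠ a := fun h => hv (h ▸ hR.symm hF.va)
  obtain ⟨y, hxy, hay⟩ := hR.exists_common hxa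
  have hyv : y ≠ v := fun h => hv (h ▸ hxy)
  refine ⟨⟨y, hyv⟩, ⟨?_, hxy, fun h => ha h.1, fun h => hb h.1⟩, ?_, hR.symm hay,
    fun h => hF.not_ab h.2, fun h => hyv (hF.eq_of_common hR (hR.symm hay) h.1)⟩
  · rintro rfl; exact ha (hR.symm hay)
  · intro h; obtain rfl : y = a := congrArg Subtype.val h; exact ha hxy

theorem near_three (hR : IsPolarity R m) (hm : 3 ≤ m) (hF : IsFrame R v a b c)
    {x : {x : P // x ≠ v}} (hb : ¬ R x b) (hxb : x.1 ≠ b) :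
    Near (blockGraph hR v a b) 3 x ⟨a, hF.ne_a⟩ := by
  classical
  by_cases hxa : x.1 = a
  · obtain rfl : x = ⟨a, hF.ne_a⟩ := Subtype.ext hxa
    exact Near.refl _ _
  by_cases ha : R x a
  · have hadj : (blockGraph hR v a b).Adj x ⟨a, hF.ne_a⟩ :=
      ⟨fun h => hxa (congrArg Subtype.val h), ha, fun h => hF.not_ab h.2, fun h => hb h.1⟩
    exact (Near.of_adj hadj).mono (by omega)
  by_cases hv : R x v
  · obtain ⟨d, hd⟩ := hF.exists_forall_adj hR x
    obtain ⟨e, hxe, hve⟩ := hR.exists_common x.2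
    obtain ⟨y, hxy, hy⟩ := hR.exists_not_mem x {x.1, d, e} (Finset.card_le_three.trans hm)
    simp only [Finset.mem_insert, Finset.mem_singleton, not_or] at hy
    obtain ⟨hyv, hadj⟩ := hd y hxy hy.1 hy.2.1
    obtain ⟨z, h₁, h₂⟩ := hF.near_two hR (x := ⟨y, hyv⟩)
      (fun h => hyv (hR.common_unique hxb hxy (hR.symm h) hv (hR.symm hF.vb)))
      (fun h => hyv (hR.common_unique hxa hxy (hR.symm h) hv (hR.symm hF.va)))
      (fun h => hy.2.2 (hR.common_unique x.2 hxy (hR.symm h) hxe hve))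
    exact ((Near.of_adj hadj).trans (Near.of_adj h₁)).trans (Near.of_adj h₂)
  · obtain ⟨y, h₁, h₂⟩ := hF.near_two hR hb ha hv
    exact ((Near.of_adj h₁).trans (Near.of_adj h₂)).mono (by omega)

theorem near_three_right (hR : IsPolarity R m) (hm : 3 ≤ m) (hF : IsFrame R v a b c)
    {x : {x : P // x ≠ v}} (ha : ¬ R x a) (hxa : x.1 ≠ a) :
    Near (blockGraph hR v a b) 3 x ⟨b, hF.ne_b⟩ := by
  rw [blockGraph_comm]
  exact (hF.swap hR).near_three hR hm ha hxa

theorem exists_path (hR : IsPolarity R m) (hm : 4 ≤ m) (hF : IsFrame R v a b c) :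
    ∃ x y z, (blockGraph hR v a b).Adj ⟨a, hF.ne_a⟩ x ∧
      (blockGraph hR v a b).Adj x y ∧ (blockGraph hR v a b).Adj y z ∧
      (blockGraph hR v a b).Adj z ⟨b, hF.ne_b⟩ := by
  have := hR.finite
  obtain ⟨y, ha, hb, hv, hyv⟩ : ∃ y, ¬ R y a ∧ ¬ R y b ∧ ¬ R y v ∧ y ≠ v := by
    by_contra! h
    have hsub : (Set.univ : Set P) ⊆ (({y | R a y} ∪ {y | R b y}) ∪ {y | R v y}) ∪ {v} := by
      intro y _
      by_cases h₁ : R y a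
      · exact Or.inl (Or.inl (Or.inl (hR.symm h₁)))
      by_cases h₂ : R y b
      · exact Or.inl (Or.inl (Or.inr (hR.symm h₂)))
      by_cases h₃ : R y v
      · exact Or.inl (Or.inr (hR.symm h₃))
      · exact Or.inr (h y h₁ h₂ h₃)
    have h₀ := Set.ncard_le_ncard hsub
    have h₁ := Set.ncard_union_le (({y | R a y} ∪ {y | R b y}) ∪ {y | R v y}) {v}
    have h₂ := Set.ncard_union_le ({y | R a y} ∪ {y | R b y}) {y | R v y}
    have h₃ := Set.ncard_union_le {y | R a y} {y | R b y}
    simp only [Set.ncard_univ, hR.card_eq, hR.ncard_eq, Set.ncard_singleton] at h₀ h₁ h₂ h₃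
    nlinarith
  obtain ⟨x, hx₁, hx₂⟩ := hF.near_two hR (x := ⟨y, hyv⟩) hb ha hv
  obtain ⟨z, hz₁, hz₂⟩ := (hF.swap hR).near_two hR (x := ⟨y, hyv⟩) ha hb hv
  rw [blockGraph_comm] at hz₁ hz₂
  exact ⟨x, ⟨y, hyv⟩, z, hx₂.symm, hx₁.symm, hz₁, hz₂⟩

theorem near_six (hR : IsPolarity R m) (hm : 4 ≤ m) (hF : IsFrame R v a b c)
    (x y : {x : P // x ≠ v}) : Near (blockGraph hR v a b) 6 x y := by
  have hnear_a : ∀ z : {x : P // x ≠ v}, (R z a ∨ z.1 = a) →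
      Near (blockGraph hR v a b) 1 z ⟨a, hF.ne_a⟩ := by
    intro z hz
    by_cases h : z.1 = a
    · obtain rfl : z = ⟨a, hF.ne_a⟩ := Subtype.ext h
      exact Near.refl _ _
    · have hz := hz.resolve_right h
      exact Near.of_adj ⟨fun h' => h (congrArg Subtype.val h'), hz, fun h' => hF.not_ab h'.2,
        fun h' => z.2 (hF.eq_of_common hR hz h'.1)⟩
  have hnear_b : ∀ z : {x : P // x ≠ v}, (R z b ∨ z.1 = b) →
      Near (blockGraph hR v a b) 1 z ⟨b, hF.ne_b⟩ := by
    intro z hz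
    by_cases h : z.1 = b
    · obtain rfl : z = ⟨b, hF.ne_b⟩ := Subtype.ext h
      exact Near.refl _ _
    · have hz := hz.resolve_right h
      exact Near.of_adj ⟨fun h' => h (congrArg Subtype.val h'), hz,
        fun h' => z.2 (hF.eq_of_common hR h'.1 hz), fun h' => hF.not_ab (hR.symm h'.2)⟩
  have hab : Near (blockGraph hR v a b) 4 ⟨a, hF.ne_a⟩ ⟨b, hF.ne_b⟩ := by
    obtain ⟨_, _, _, h₁, h₂, h₃, h₄⟩ := hF.exists_path hR hm
    exact (((Near.of_adj h₁).trans (Near.of_adj h₂)).trans (Near.of_adj h₃)).trans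
      (Near.of_adj h₄)
  have hdisj : ∀ z : {x : P // x ≠ v}, (R z a ∨ z.1 = a) → (R z b ∨ z.1 = b) → False := by
    rintro z (h | h) (h' | h')
    · exact z.2 (hF.eq_of_common hR h h')
    · exact hF.not_ab (hR.symm (h' ▸ h))
    · exact hF.not_ab (h ▸ h')
    · exact hF.a_ne_b (h.symm.trans h')
  have hfar_a : ∀ z : {x : P // x ≠ v}, ¬ (R z b ∨ z.1 = b) →
      Near (blockGraph hR v a b) 3 z ⟨a, hF.ne_a⟩ := fun z hz =>
    hF.near_three hR (by omega) (fun h => hz (Or.inl h)) (fun h => hz (Or.inr h))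
  have hfar_b : ∀ z : {x : P // x ≠ v}, ¬ (R z a ∨ z.1 = a) →
      Near (blockGraph hR v a b) 3 z ⟨b, hF.ne_b⟩ := fun z hz =>
    hF.near_three_right hR (by omega) (fun h => hz (Or.inl h)) (fun h => hz (Or.inr h))
  by_cases hxb : R x b ∨ x.1 = b
  · by_cases hya : R y a ∨ y.1 = a
    · exact ((hnear_b x hxb).trans hab.symm).trans (hnear_a y hya).symm
    · exact (hfar_b x fun h => hdisj x h hxb).trans (hfar_b y hya).symm
  · by_cases hyb : R y b ∨ y.1 = b
    · by_cases hxa : R x a ∨ x.1 = a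
      · exact ((hnear_a x hxa).trans hab).trans (hnear_b y hyb).symm
      · exact (hfar_b x hxa).trans (hfar_b y fun h => hdisj y h hyb).symm
    · exact (hfar_a x hxb).trans (hfar_a y hyb).symm

end IsFrame

section CycleDist

variable {q : ℕ}

theorem cycleDist_comm (i j : ZMod q) : cycleDist i j = cycleDist j i := min_comm _ _

theorem cycleDist_neg (i j : ZMod q) : cycleDist (-i) (-j) = cycleDist i j := by
  rw [cycleDist_comm i j]
  simp only [cycleDist, neg_sub_neg]

theorem cycleDist_eq_natAbs [NeZero q] (i j : ZMod q) :
    cycleDist i j = (i - j).valMinAbs.natAbs := by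
  rw [ZMod.valMinAbs_natAbs_eq_min, cycleDist, ← neg_sub i j, ZMod.neg_val]
  split_ifs with h <;> simp [h]

theorem cycleDist_self (i : ZMod q) : cycleDist i i = 0 := by
  simp [cycleDist]

theorem cycleDist_triangle [NeZero q] (i j k : ZMod q) :
    cycleDist i k ≤ cycleDist i j + cycleDist j k := by
  simp only [cycleDist_eq_natAbs]
  rw [← sub_add_sub_cancel i j k]
  exact (ZMod.natAbs_valMinAbs_add_le _ _).trans (Int.natAbs_add_le _ _)

theorem eq_of_cycleDist_eq_zero [NeZero q] {i j : ZMod q} (h : cycleDist i j = 0) : i = j := by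
  rw [cycleDist_eq_natAbs, Int.natAbs_eq_zero, ZMod.valMinAbs_eq_zero] at h
  exact sub_eq_zero.1 h

theorem cycleDist_add_natCast [NeZero q] (i : ZMod q) {k : ℕ} (hk : 2 * k ≤ q) :
    cycleDist i (i + k) = k := by
  rw [cycleDist_comm, cycleDist_eq_natAbs, add_sub_cancel_left,
    ZMod.valMinAbs_natCast_of_le_half (by omega), Int.natAbs_natCast]

theorem cycleDist_add_one_le [NeZero q] (i : ZMod q) : cycleDist i (i + 1) ≤ 1 := by
  refine (min_le_right _ _).trans ?_
  rw [add_sub_cancel_left]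
  rw [ZMod.val_one_eq_one_mod]
  exact Nat.mod_le _ _

end CycleDist

namespace IsIsoCycle

variable {V : Type*} {G : SimpleGraph V} {q : ℕ} {f : ZMod q → V}

theorem dist_add_natCast [NeZero q] (hf : IsIsoCycle G q f) (t : ZMod q) {k : ℕ} (hk : 2 * k ≤ q) :
    G.dist (f t) (f (t + k)) = k := by
  rw [hf.2, cycleDist_add_natCast t hk]

theorem injective [NeZero q] (hf : IsIsoCycle G q f) : Function.Injective f := by
  intro s t hst
  apply eq_of_cycleDist_eq_zero
  rw [← hf.2, hst, SimpleGraph.dist_self]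

theorem adj_add_one [NeZero q] (hf : IsIsoCycle G q f) (t : ZMod q) : G.Adj (f t) (f (t + 1)) := by
  rw [← SimpleGraph.dist_eq_one_iff_adj]
  have := hf.dist_add_natCast t (k := 1) (by have := hf.1; omega)
  simpa using this

theorem neg (hf : IsIsoCycle G q f) : IsIsoCycle G q fun t => f (-t) :=
  ⟨hf.1, fun s t => by rw [hf.2, cycleDist_neg]⟩

end IsIsoCycle

/-- A block: a graph of small diameter with two ends `a`, `b` at distance four, as witnessed
by the function `h`. -/
structure IsBlock {X : Type*} (B : SimpleGraph X) (a b : X) (h : X → ℕ) : Prop where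
  h_left : h a = 0
  h_right : h b = 4
  h_le : ∀ {x y}, B.Adj x y → h y ≤ h x + 1
  near : ∀ x y, Near B 6 x y
  exists_path : ∃ p : ℕ → X, p 0 = a ∧ p 4 = b ∧ ∀ i < 4, B.Adj (p i) (p (i + 1))

/-- `j` copies of `B` arranged in a ring, where `b` in each copy is joined to `a` in the
next copy. -/
def ringGraph {X : Type*} (j : ℕ) (B : SimpleGraph X) {a b : X} (hab : a ≠ b) :
    SimpleGraph (ZMod j × X) where
  Adj u v := (u.1 = v.1 ∧ B.Adj u.2 v.2) ∨ (v.1 = u.1 + 1 ∧ u.2 = b ∧ v.2 = a) ∨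
    (u.1 = v.1 + 1 ∧ v.2 = b ∧ u.2 = a)
  symm := ⟨fun u v h => by
    rcases h with h | h | h
    · exact Or.inl ⟨h.1.symm, h.2.symm⟩
    · exact Or.inr (Or.inr h)
    · exact Or.inr (Or.inl h)⟩
  loopless := ⟨fun u h => by
    rcases h with h | h | h
    · exact h.2.ne rfl
    · exact hab (h.2.2.symm.trans h.2.1)
    · exact hab (h.2.2.symm.trans h.2.1)⟩

namespace IsBlock

variable {X : Type*} {B : SimpleGraph X} {a b : X} {h : X → ℕ} {j : ℕ}

theorem ne (hB : IsBlock B a b h) : a ≠ b := by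
  rintro rfl
  have := hB.h_left.symm.trans hB.h_right
  omega

theorem near_four (hB : IsBlock B a b h) : Near B 4 a b := by
  obtain ⟨p, rfl, rfl, hp⟩ := hB.exists_path
  exact (((Near.of_adj (hp 0 (by omega))).trans (Near.of_adj (hp 1 (by omega)))).trans
    (Near.of_adj (hp 2 (by omega)))).trans (Near.of_adj (hp 3 (by omega)))

theorem link_adj (hB : IsBlock B a b h) (i : ZMod j) :
    (ringGraph j B hB.ne).Adj (i, b) (i + 1, a) := Or.inr (Or.inl ⟨rfl, rfl, rfl⟩)

theorem near_copy (hB : IsBlock B a b h) (i : ZMod j) {n : ℕ} {x y : X} (hxy : Near B n x y) :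
    Near (ringGraph j B hB.ne) n (i, x) (i, y) :=
  hxy.map (H := ringGraph j B hB.ne) ⟨fun x => (i, x), fun h => Or.inl ⟨rfl, h⟩⟩

theorem connected (hB : IsBlock B a b h) [NeZero j] : (ringGraph j B hB.ne).Connected := by
  have hk : ∀ k : ℕ, (ringGraph j B hB.ne).Reachable ((0 : ZMod j), a) ((k : ZMod j), a) := by
    intro k
    induction k with
    | zero => simp
    | succ k ih =>
      rw [Nat.cast_succ]
      exact (ih.trans (hB.near_copy _ hB.near_four).reachable).trans (hB.link_adj _).reachable
  have hu : ∀ u, (ringGraph j B hB.ne).Reachable ((0 : ZMod j), a) u := by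
    rintro ⟨i, x⟩
    have := (hk i.val).trans (hB.near_copy _ (hB.near a x)).reachable
    rwa [ZMod.natCast_zmod_val] at this
  exact (SimpleGraph.connected_iff _).2 ⟨fun u v => (hu u).symm.trans (hu v), ⟨(0, a)⟩⟩

theorem c4free (hB : IsBlock B a b h) (hj : 3 ≤ j)
    (hC : ∀ w x y z : X, B.Adj w x → B.Adj x y → B.Adj y z → B.Adj z w → w = y ∨ x = z)
    (w x y z : ZMod j × X) (h₁ : (ringGraph j B hB.ne).Adj w x)
    (h₂ : (ringGraph j B hB.ne).Adj x y) (h₃ : (ringGraph j B hB.ne).Adj y z)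
    (h₄ : (ringGraph j B hB.ne).Adj z w) : w = y ∨ x = z := by
  have h2 : ∀ i : ZMod j, i ≠ i + 1 + 1 := by
    intro i hi
    have : ((2 : ℕ) : ZMod j) = 0 := by push_cast; linear_combination -hi
    rw [ZMod.natCast_eq_zero_iff] at this
    exact absurd (Nat.le_of_dvd (by omega) this) (by omega)
  have h1 : ∀ i : ZMod j, i ≠ i + 1 := by
    intro i hi
    exact h2 i (hi.trans (congrArg (· + 1) hi))
  have hab := hB.ne
  obtain ⟨w₁, w₂⟩ := w
  obtain ⟨x₁, x₂⟩ := x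
  obtain ⟨y₁, y₂⟩ := y
  obtain ⟨z₁, z₂⟩ := z
  simp only [ringGraph, Prod.mk.injEq] at *
  have hw := hC w₂ x₂ y₂ z₂
  have ha : ¬ B.Adj a a := fun h => h.ne rfl
  have hb : ¬ B.Adj b b := fun h => h.ne rfl
  have hw1 := h1 w₁
  have hx1 := h1 x₁
  have hy1 := h1 y₁
  have hz1 := h1 z₁
  have hw2 := h2 w₁
  have hx2 := h2 x₁
  have hy2 := h2 y₁
  have hz2 := h2 z₁
  clear hC h1 h2 hB
  grind

theorem le_ndeg [Finite X] [NeZero j] (hB : IsBlock B a b h) (u : ZMod j × X) :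
    ndeg B u.2 ≤ ndeg (ringGraph j B hB.ne) u := by
  have hsub : (fun y => (u.1, y)) '' B.neighborSet u.2 ⊆ (ringGraph j B hB.ne).neighborSet u := by
    rintro _ ⟨y, hy, rfl⟩
    exact Or.inl ⟨rfl, hy⟩
  have := Set.ncard_le_ncard hsub
  rwa [Set.ncard_image_of_injective _ (Prod.mk_right_injective u.1)] at this

theorem ndeg_eq (hB : IsBlock B a b h) (i : ZMod j) {x : X} (ha : x ≠ a) (hb : x ≠ b) :
    ndeg (ringGraph j B hB.ne) (i, x) = ndeg B x := by
  have heq : (ringGraph j B hB.ne).neighborSet (i, x) = (fun y => (i, y)) '' B.neighborSet x := by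
    ext ⟨k, y⟩
    constructor
    · rintro (⟨rfl, h⟩ | h | h)
      · exact ⟨y, h, rfl⟩
      · exact absurd h.2.1 hb
      · exact absurd h.2.2 ha
    · rintro ⟨y, hy, he⟩
      rw [← he]
      exact Or.inl ⟨rfl, hy⟩
  rw [ndeg, heq, Set.ncard_image_of_injective _ (Prod.mk_right_injective i)]
  rfl

/-- The projection of the ring of blocks onto a cycle of length `5 * j`. -/
def toCycle (j : ℕ) (h : X → ℕ) (u : ZMod j × X) : ZMod (5 * j) :=
  ((5 * u.1.val + h u.2 : ℕ) : ZMod (5 * j))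

theorem toCycle_link [NeZero j] (hB : IsBlock B a b h) (i : ZMod j) :
    toCycle j h (i + 1, a) = toCycle j h (i, b) + 1 := by
  simp only [toCycle, hB.h_left, hB.h_right]
  have hi := ZMod.val_lt i
  have hv : (i + 1).val = (i.val + 1) % j := by
    rw [← ZMod.val_natCast]
    simp
  rw [hv]
  norm_cast
  rw [ZMod.natCast_eq_natCast_iff]
  rcases (Nat.succ_le_of_lt hi).lt_or_eq with h | h
  · rw [Nat.mod_eq_of_lt h]
    exact congrArg (· % (5 * j)) (by omega : 5 * (i.val + 1) + 0 = 5 * i.val + 4 + 1)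
  · rw [← Nat.succ_eq_add_one, h, Nat.mod_self, add_assoc]
    have : 5 * i.val + (4 + 1) = 5 * j := by omega
    rw [this]
    exact (Nat.modEq_zero_iff_dvd.2 dvd_rfl).symm

theorem cycleDist_toCycle_adj [NeZero j] (hB : IsBlock B a b h) {u v : ZMod j × X}
    (huv : (ringGraph j B hB.ne).Adj u v) :
    cycleDist (toCycle j h u) (toCycle j h v) ≤ 1 := by
  obtain ⟨i, x⟩ := u
  obtain ⟨k, y⟩ := v
  rcases huv with ⟨hik, hxy⟩ | ⟨hk, hx, hy⟩ | ⟨hk, hx, hy⟩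
  · obtain rfl : i = k := hik
    have h₁ := hB.h_le hxy
    have h₂ := hB.h_le hxy.symm
    simp only at h₁ h₂
    rcases lt_trichotomy (h x) (h y) with hlt | heq | hlt
    · have : h y = h x + 1 := by omega
      simp only [toCycle, this, ← add_assoc]
      rw [Nat.cast_succ]
      exact cycleDist_add_one_le _
    · simp only [toCycle, heq, cycleDist_self, zero_le]
    · have : h x = h y + 1 := by omega
      simp only [toCycle, this, ← add_assoc]
      rw [Nat.cast_succ, cycleDist_comm]
      exact cycleDist_add_one_le _
  · simp only at hk hx hy
    subst hk hx hy
    rw [hB.toCycle_link]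
    exact cycleDist_add_one_le _
  · simp only at hk hx hy
    subst hk hx hy
    rw [hB.toCycle_link, cycleDist_comm]
    exact cycleDist_add_one_le _

theorem cycleDist_toCycle_le_dist [NeZero j] (hB : IsBlock B a b h) (u v : ZMod j × X) :
    cycleDist (toCycle j h u) (toCycle j h v) ≤ (ringGraph j B hB.ne).dist u v := by
  obtain ⟨p, hp⟩ := hB.connected.exists_walk_length_eq_dist u v
  rw [← hp]
  clear hp
  induction p with
  | nil => simp [cycleDist_self]
  | cons huv p ih =>
    rw [Walk.length_cons]
    exact (cycleDist_triangle _ _ _).trans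
      ((add_le_add (hB.cycleDist_toCycle_adj huv) ih).trans (by omega))

theorem hasIsoCycle (hB : IsBlock B a b h) (hj : 3 ≤ j) :
    HasIsoCycle (ringGraph j B hB.ne) (5 * j) := by
  have : NeZero j := ⟨by omega⟩
  obtain ⟨p, hp0, hp4, hp⟩ := hB.exists_path
  have hlevel : ∀ i < 5, h (p i) = i := by
    have h₀ := hB.h_left
    have h₄ := hB.h_right
    rw [← hp0] at h₀
    rw [← hp4] at h₄
    have h₁ := hB.h_le (hp 0 (by omega))
    have h₂ := hB.h_le (hp 1 (by omega))
    have h₃ := hB.h_le (hp 2 (by omega))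
    have h₅ := hB.h_le (hp 3 (by omega))
    norm_num at h₁ h₂ h₃ h₅
    intro i hi
    interval_cases i <;> omega
  let F : ℕ → ZMod j × X := fun n => ((n / 5 : ℕ), p (n % 5))
  have hF_mod : ∀ n, F (n % (5 * j)) = F n := by
    intro n
    simp only [F, Nat.mod_mul_right_div_self, Nat.mod_mul_right_mod, ZMod.natCast_mod]
  have hF_adj : ∀ n, (ringGraph j B hB.ne).Adj (F n) (F (n + 1)) := by
    intro n
    by_cases h4 : n % 5 = 4
    · have h₁ : (n + 1) / 5 = n / 5 + 1 := by omega
      have h₂ : (n + 1) % 5 = 0 := by omega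
      simp only [F, h4, h₁, h₂, hp0, hp4, Nat.cast_succ]
      exact hB.link_adj _
    · have h₁ : (n + 1) / 5 = n / 5 := by omega
      have h₂ : (n + 1) % 5 = n % 5 + 1 := by omega
      simp only [F, h₁, h₂]
      exact Or.inl ⟨rfl, hp _ (by omega)⟩
  have hF_near : ∀ n k, Near (ringGraph j B hB.ne) k (F n) (F (n + k)) := by
    intro n k
    induction k with
    | zero => exact Near.refl _ _
    | succ k ih => exact ih.trans (Near.of_adj (hF_adj _))
  have hle : ∀ s t : ZMod (5 * j),
      (ringGraph j B hB.ne).dist (F s.val) (F t.val) ≤ (t - s).val := by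
    intro s t
    have ht : F t.val = F (s.val + (t - s).val) := by
      rw [← hF_mod (s.val + (t - s).val), ← ZMod.val_add, add_sub_cancel]
    rw [ht]
    exact (hF_near _ _).dist_le
  refine ⟨fun t => F t.val, by omega, fun s t => le_antisymm (le_min ?_ (hle s t)) ?_⟩
  · rw [SimpleGraph.dist_comm]
    exact hle t s
  · have hid : ∀ t : ZMod (5 * j), toCycle j h (F t.val) = t := by
      intro t
      have ht := ZMod.val_lt t
      have hdiv : t.val / 5 < j := by omega
      simp only [toCycle, F, hlevel _ (Nat.mod_lt t.val (by norm_num : 5 > 0)),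
        ZMod.val_cast_of_lt hdiv]
      rw [Nat.div_add_mod, ZMod.natCast_zmod_val]
    have := hB.cycleDist_toCycle_le_dist (F s.val) (F t.val)
    rwa [hid, hid] at this

section UpperBound

variable {q : ℕ} {f : ZMod q → ZMod j × X}

theorem adj_cases (hB : IsBlock B a b h) {u v : ZMod j × X}
    (huv : (ringGraph j B hB.ne).Adj u v) (hne : u.1 ≠ v.1) :
    (∃ i, u = (i, b) ∧ v = (i + 1, a)) ∨ (∃ i, v = (i, b) ∧ u = (i + 1, a)) := by
  obtain ⟨i, x⟩ := u
  obtain ⟨k, y⟩ := v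
  rcases huv with ⟨hik, -⟩ | ⟨hk, hx, hy⟩ | ⟨hk, hx, hy⟩
  · exact absurd hik hne
  · simp only at hk hx hy
    subst hk hx hy
    exact Or.inl ⟨i, rfl, rfl⟩
  · simp only at hk hx hy
    subst hk hx hy
    exact Or.inr ⟨k, rfl, rfl⟩

theorem isoCycle_block_ne (hB : IsBlock B a b h) [NeZero q]
    (hf : IsIsoCycle (ringGraph j B hB.ne) q f) (hq : 14 ≤ q) (t : ZMod q) :
    (f t).1 ≠ (f (t + 7)).1 := by
  intro heq
  have h₁ := hf.dist_add_natCast t (k := 7) hq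
  have h₂ := (hB.near_copy (f t).1 (hB.near (f t).2 (f (t + 7)).2)).dist_le
  nth_rw 2 [heq] at h₂
  simp only [Prod.mk.eta] at h₂
  push_cast at h₁
  omega

/-- A long isometric cycle that enters a block through one end leaves it through the other end
after at most five steps. -/
theorem isoCycle_next (hB : IsBlock B a b h) [NeZero q]
    (hf : IsIsoCycle (ringGraph j B hB.ne) q f) (hq : 14 ≤ q) {t : ZMod q} {i : ZMod j}
    (h₀ : f t = (i, b)) (h₁ : f (t + 1) = (i + 1, a)) :
    ∃ s : ℕ, 1 ≤ s ∧ s ≤ 5 ∧ f (t + s) = (i + 1, b) ∧ f (t + s + 1) = (i + 1 + 1, a) := by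
  classical
  have hex : ∃ s : ℕ, (f (t + 1 + s)).1 ≠ i + 1 := by
    refine ⟨7, fun h7 => hB.isoCycle_block_ne hf hq (t + 1) ?_⟩
    rw [h₁]
    exact_mod_cast h7.symm
  obtain ⟨s, hs, hmin⟩ : ∃ s : ℕ, (f (t + 1 + s)).1 ≠ i + 1 ∧
      ∀ r < s, (f (t + 1 + r)).1 = i + 1 :=
    ⟨Nat.find hex, Nat.find_spec hex, fun r hr => not_not.1 (Nat.find_min hex hr)⟩
  have hs0 : s ≠ 0 := by
    rintro rfl
    simp [h₁] at hs
  obtain ⟨r, rfl⟩ := Nat.exists_eq_succ_of_ne_zero hs0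
  have hr7 : r < 7 := by
    by_contra! hr
    refine hB.isoCycle_block_ne hf hq (t + 1) ?_
    rw [h₁]
    exact_mod_cast (hmin 7 (by omega)).symm
  have hr := hmin r (by omega)
  have hadj := hf.adj_add_one (t + 1 + r)
  rw [Nat.succ_eq_add_one, Nat.cast_succ, ← add_assoc] at hs
  rcases hB.adj_cases hadj (by rw [hr]; exact hs.symm) with ⟨k, hk, hk'⟩ | ⟨k, hk, hk'⟩
  · obtain rfl : k = i + 1 := by rw [hk] at hr; exact hr
    have hd := hf.dist_add_natCast (t + 1) (k := r) (by omega)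
    have hd' := (hB.near_copy (i + 1) hB.near_four).dist_le
    rw [h₁, hk] at hd
    refine ⟨r + 1, by omega, by omega, ?_, ?_⟩
    · rw [← hk]
      congr 1
      push_cast
      ring
    · rw [← hk']
      congr 1
      push_cast
      ring
  · obtain rfl : k = i := by
      rw [hk'] at hr
      exact add_right_cancel hr
    have := hf.injective (hk.trans h₀.symm)
    have h0 : ((r + 2 : ℕ) : ZMod q) = 0 := by
      push_cast
      linear_combination this
    rw [ZMod.natCast_eq_zero_iff] at h0
    exact absurd (Nat.le_of_dvd (by omega) h0) (by omega)

theorem isoCycle_le_of_link (hB : IsBlock B a b h) (hj : 3 ≤ j) [NeZero q]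
    (hf : IsIsoCycle (ringGraph j B hB.ne) q f) (hq : 14 ≤ q) {t : ZMod q} {i : ZMod j}
    (h₀ : f t = (i, b)) (h₁ : f (t + 1) = (i + 1, a)) : q ≤ 5 * j := by
  have hk : ∀ k : ℕ, ∃ s : ℕ, k ≤ s ∧ s ≤ 5 * k ∧ f (t + s) = (i + k, b) ∧
      f (t + s + 1) = (i + k + 1, a) := by
    intro k
    induction k with
    | zero => exact ⟨0, by simp [h₀, h₁]⟩
    | succ k ih =>
      obtain ⟨s, hs₁, hs₂, hs₃, hs₄⟩ := ih
      obtain ⟨r, hr₁, hr₂, hr₃, hr₄⟩ := hB.isoCycle_next hf hq hs₃ hs₄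
      refine ⟨s + r, by omega, by omega, ?_, ?_⟩
      · simpa only [Nat.cast_add, Nat.cast_one, ← add_assoc] using hr₃
      · simpa only [Nat.cast_add, Nat.cast_one, ← add_assoc] using hr₄
  obtain ⟨s, hs₁, hs₂, hs₃, -⟩ := hk j
  rw [ZMod.natCast_self, add_zero, ← h₀] at hs₃
  have h0 : (s : ZMod q) = 0 := by simpa using hf.injective hs₃
  rw [ZMod.natCast_eq_zero_iff] at h0
  exact (Nat.le_of_dvd (by omega) h0).trans hs₂

theorem isoCycle_le (hB : IsBlock B a b h) (hj : 3 ≤ j)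
    (hq : HasIsoCycle (ringGraph j B hB.ne) q) : q ≤ 5 * j := by
  obtain ⟨f, hf⟩ := hq
  have : NeZero q := ⟨by have := hf.1; omega⟩
  by_contra! hlt
  have hq : 14 ≤ q := by omega
  obtain ⟨t, ht⟩ : ∃ t, (f t).1 ≠ (f (t + 1)).1 := by
    by_contra! hc
    have hk : ∀ k : ℕ, (f 0).1 = (f (0 + k)).1 := by
      intro k
      induction k with
      | zero => simp
      | succ k ih => rw [ih, hc, Nat.cast_succ, add_assoc]
    exact hB.isoCycle_block_ne hf hq 0 (hk 7)
  rcases hB.adj_cases (hf.adj_add_one t) ht with ⟨i, h₀, h₁⟩ | ⟨i, h₀, h₁⟩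
  · exact absurd (hB.isoCycle_le_of_link hj hf hq h₀ h₁) (by omega)
  · refine absurd (hB.isoCycle_le_of_link hj hf.neg hq (t := -(t + 1)) (i := i) ?_ ?_)
      (by omega)
    · simpa using h₀
    · simpa using h₁

end UpperBound

theorem isEquator (hB : IsBlock B a b h) (hj : 3 ≤ j) :
    IsEquator (ringGraph j B hB.ne) (5 * j) :=
  ⟨Or.inl (hB.hasIsoCycle hj), fun _ hq => hB.isoCycle_le hj hq⟩

end IsBlock

theorem IsFrame.isBlock {P : Type*} {R : P → P → Prop} {m : ℕ} {v a b c : P}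
    (hR : IsPolarity R m) (hm : 4 ≤ m) (hF : IsFrame R v a b c) :
    IsBlock (blockGraph hR v a b) ⟨a, hF.ne_a⟩ ⟨b, hF.ne_b⟩ (fun x => level R a b x) where
  h_left := by simp [level]
  h_right := by simp [level, hF.a_ne_b.symm]
  h_le := hF.level_le hR
  near := hF.near_six hR hm
  exists_path := by
    obtain ⟨x, y, z, h₁, h₂, h₃, h₄⟩ := hF.exists_path hR hm
    refine ⟨fun n => match n with
      | 0 => ⟨a, hF.ne_a⟩
      | 1 => x
      | 2 => y
      | 3 => z
      | _ => ⟨b, hF.ne_b⟩, rfl, rfl, fun i hi => ?_⟩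
    interval_cases i
    exacts [h₁, h₂, h₃, h₄]


/-- Proposition 4.5: near-sharpness of the `C₄`-free bound via Brown graphs. -/
theorem stmt_5 (j δ : ℕ) (hj : 3 ≤ j) (hδ : 3 ≤ δ) (hpp : IsPrimePow (δ + 1)) :
    ∃ (W : Type) (H : SimpleGraph W), Finite W ∧ H.Connected ∧
      (∀ a b c d : W, H.Adj a b → H.Adj b c → H.Adj c d → H.Adj d a → a = c ∨ b = d) ∧
      HasMinDegree H δ ∧ IsEquator H (5 * j) ∧
      Nat.card W = j * (δ ^ 2 + 3 * δ + 2) := by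
  obtain ⟨P, R, hR, c, hc⟩ := exists_isPolarity_isotropic hpp
  obtain ⟨v, a, b, hF⟩ := hR.exists_isFrame (by omega) hc
  have hB := hF.isBlock hR (by omega)
  have := hR.finite
  have : NeZero j := ⟨by omega⟩
  refine ⟨ZMod j × {x : P // x ≠ v}, ringGraph j _ hB.ne, inferInstance, hB.connected,
    hB.c4free hj (IsFrame.block_c4free hR), ⟨fun u => (hF.le_ndeg hR u.2).trans (hB.le_ndeg u),
    ⟨0, c, hF.ne_c⟩, ?_⟩, hB.isEquator hj, ?_⟩
  · rw [hB.ndeg_eq 0 (fun h => hF.c_ne_a (congrArg Subtype.val h))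
      (fun h => hF.c_ne_b (congrArg Subtype.val h))]
    exact le_antisymm (hF.ndeg_isotropic_le hR) (hF.le_ndeg hR _)
  · have hcard : Nat.card {x : P // x ≠ v} + 1 = Nat.card P := by
      have := Set.ncard_add_ncard_compl ({v} : Set P)
      rw [Set.ncard_singleton, add_comm] at this
      exact this
    rw [hR.card_eq] at hcard
    rw [Nat.card_prod, Nat.card_zmod]
    congr 1
    linarith
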